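/- arXiv:2505.04342 — 2 statements merged into one kernel-verified Lean document; each statement's English description precedes it below -/
import Mathlib

section
/- For every spline h on (G, m, r) and every vertex v of G, the value h(v) lies in the ideal K(v) of ℤ; equivalently, the nonnegative generator of the ideal K(v), namely lcm( m(v), { gcd( m(u), lcm over trails W from u to v of g(W) ) : u ≠ v } ), divides h(v). -/
/-- `g(W)`: the gcd of the edge labels traversed by a walk `W`
(equal to `0` for a walk with no edges). -/
def walkGcd {V : Type*} {G : SimpleGraph V} (r : V → V → ℤ) {u v : V}
    (W : G.Walk u v) : ℤ :=
  (W.darts.map (fun d => r d.toProd.1 d.toProd.2)).foldr gcd 0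

/-- `I(u, v)`: the intersection of the ideals `g(W)ℤ` over all trails `W`
from `u` to `v` (equal to `ℤ` when there is no such trail). -/
def trailIdeal {V : Type*} (G : SimpleGraph V) (r : V → V → ℤ) (u v : V) :
    Ideal ℤ :=
  ⨅ (W : G.Walk u v) (_ : W.IsTrail), Ideal.span {walkGcd r W}

/-- `K(v) = m(v)ℤ ∩ ⋂_{u ≠ v} (m(u)ℤ + I(u, v))`. -/
def vertexIdeal {V : Type*} (G : SimpleGraph V) (m : V → ℤ)
    (r : V → V → ℤ) (v : V) : Ideal ℤ :=
  Ideal.span {m v} ⊓ ⨅ (u : V) (_ : u ≠ v), (Ideal.span {m u} ⊔ trailIdeal G r u v)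

/-- The gcd of the edge labels along a walk divides the difference of the values of a function
satisfying the edge conditions at the endpoints of the walk. -/
theorem walkGcd_dvd_sub {V : Type*} {G : SimpleGraph V} {r : V → V → ℤ} {h : V → ℤ}
    (hedge : ∀ u w, G.Adj u w → r u w ∣ h u - h w) {u v : V} (W : G.Walk u v) :
    walkGcd r W ∣ h v - h u := by
  induction W with
  | nil => simp
  | @cons a b c hab p ih =>
    have key : walkGcd r (SimpleGraph.Walk.cons hab p) = gcd (r a b) (walkGcd r p) := by
      simp [walkGcd]
    rw [key, ← sub_sub_sub_cancel_right (h c) (h a) (h b)]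
    exact dvd_sub ((gcd_dvd_right _ _).trans ih) ((gcd_dvd_left _ _).trans (hedge a b hab))

/-- for every spline `h` on `(G, m, r)` and every vertex `v`,
the value `h v` lies in the ideal `K(v)`. -/
theorem spline_value_mem_vertexIdeal {n : ℕ} (G : SimpleGraph (Fin n))
    (m : Fin n → ℤ) (r : Fin n → Fin n → ℤ) (hr : ∀ u w, r u w = r w u)
    (h : Fin n → ℤ)
    (hspline : (∀ v, m v ∣ h v) ∧ ∀ u w, G.Adj u w → r u w ∣ h u - h w)
    (v : Fin n) :
    h v ∈ vertexIdeal G m r v := by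
  obtain ⟨hvertex, hedge⟩ := hspline
  refine Submodule.mem_inf.2 ⟨Ideal.mem_span_singleton.2 (hvertex v), ?_⟩
  simp only [Submodule.mem_iInf]
  intro u _
  rw [← add_sub_cancel (h u) (h v)]
  refine Submodule.add_mem_sup (Ideal.mem_span_singleton.2 (hvertex u)) ?_
  simp only [trailIdeal, Submodule.mem_iInf]
  exact fun W _ => Ideal.mem_span_singleton.2 (walkGcd_dvd_sub hedge W)
end

section
/- Suppose that for each 1 ≤ i ≤ n, F^(i) is a spline on the edge-labeled cycle C_n with F^(i)_s = 0 for all s < i and F^(i)_i = c_i. Then {F^(1), …, F^(n)} is a ℤ-module basis of the module of splines on C_n: every spline f can be written uniquely as f = a_1 F^(1) + ⋯ + a_n F^(n) with a_1, …, a_n ∈ ℤ. -/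
/-- `c i` (0-indexed) for the cycle `Cₙ` with vertex labels `m 0, …, m (n-1)`,
path edge labels `r 0, …, r (n-2)` (edge `v_j v_{j+1}` labeled `r j`) and
closing edge `v_0 v_{n-1}` labeled `r (n-1)`.
For `i = 0` it is the lcm of `m 0`, the `gcd (m j) (gcd (r 0, …, r (j-1)))`
for `1 ≤ j ≤ n-1`, and the `gcd (m j) (gcd (r j, …, r (n-1)))` for
`1 ≤ j ≤ n-1`. For `i ≥ 1` it is the lcm of `m i`, `r (i-1)`, the
`gcd (m j) (gcd (r i, …, r (j-1)))` for `i+1 ≤ j ≤ n-1`, and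
`gcd (r i, …, r (n-1))`. -/
def cycleC (n : ℕ) (m r : ℕ → ℤ) (i : ℕ) : ℤ :=
  if i = 0 then
    lcm (m 0) (lcm
      ((Finset.Ico 1 n).lcm (fun j => gcd (m j) ((Finset.Ico 0 j).gcd r)))
      ((Finset.Ico 1 n).lcm (fun j => gcd (m j) ((Finset.Ico j n).gcd r))))
  else
    lcm (lcm (m i) (r (i - 1)))
      (lcm ((Finset.Ico (i + 1) n).lcm
          (fun j => gcd (m j) ((Finset.Ico i j).gcd r)))
        ((Finset.Ico i n).gcd r))

/-- The ℤ-module of splines on the cycle with vertex labels `m` and edge labels `r`. -/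
def cycleSplines (n : ℕ) (m r : ℕ → ℤ) : Submodule ℤ (ℕ → ℤ) where
  carrier := {f | (∀ j < n, m j ∣ f j) ∧ (∀ j, j + 1 < n → r j ∣ f (j + 1) - f j) ∧
    r (n - 1) ∣ f 0 - f (n - 1)}
  zero_mem' := by simp
  add_mem' := by
    rintro f g ⟨hf, hf', hf''⟩ ⟨hg, hg', hg''⟩
    refine ⟨fun j hj => dvd_add (hf j hj) (hg j hj), fun j hj => ?_, ?_⟩
    · simpa [add_sub_add_comm] using dvd_add (hf' j hj) (hg' j hj)
    · simpa [add_sub_add_comm] using dvd_add hf'' hg''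
  smul_mem' := by
    rintro a f ⟨hf, hf', hf''⟩
    refine ⟨fun j hj => (hf j hj).mul_left a, fun j hj => ?_, ?_⟩
    · simpa [mul_sub] using (hf' j hj).mul_left a
    · simpa [mul_sub] using hf''.mul_left a

/-- The common divisor of consecutive edge labels divides the difference of the end values. -/
theorem gcd_Ico_dvd_sub {f r : ℕ → ℤ} {i j : ℕ} (hij : i ≤ j)
    (h : ∀ k, i ≤ k → k < j → r k ∣ f (k + 1) - f k) :
    (Finset.Ico i j).gcd r ∣ f j - f i := by
  rw [← Finset.sum_Ico_sub f hij]
  refine Finset.dvd_sum fun k hk => (Finset.gcd_dvd hk).trans ?_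
  exact h k (Finset.mem_Ico.mp hk).1 (Finset.mem_Ico.mp hk).2

theorem gcd_Ico_dvd_sub_of_mem_cycleSplines {n : ℕ} {m r f : ℕ → ℤ}
    (hf : f ∈ cycleSplines n m r) {i j : ℕ} (hij : i ≤ j) (hj : j < n) :
    (Finset.Ico i j).gcd r ∣ f j - f i :=
  gcd_Ico_dvd_sub hij fun k _ hk => hf.2.1 k (by omega)

/-- Going around the cycle from `i` to `0` through the closing edge. -/
theorem gcd_Ico_dvd_zero_sub_of_mem_cycleSplines {n : ℕ} {m r f : ℕ → ℤ}
    (hf : f ∈ cycleSplines n m r) {i : ℕ} (hi : i < n) :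
    (Finset.Ico i n).gcd r ∣ f 0 - f i := by
  have hpath : (Finset.Ico i n).gcd r ∣ f (n - 1) - f i :=
    (Finset.gcd_mono (Finset.Ico_subset_Ico_right (Nat.sub_le n 1))).trans
      (gcd_Ico_dvd_sub_of_mem_cycleSplines hf (by omega) (by omega))
  have hclose : (Finset.Ico i n).gcd r ∣ f 0 - f (n - 1) :=
    (Finset.gcd_dvd (Finset.mem_Ico.mpr ⟨by omega, by omega⟩)).trans hf.2.2
  simpa using dvd_add hclose hpath

/-- `cycleC n m r i` divides the leading entry of every spline vanishing before `i`. -/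
theorem cycleC_dvd_of_mem_cycleSplines {n : ℕ} {m r f : ℕ → ℤ}
    (hf : f ∈ cycleSplines n m r) {i : ℕ} (hi : i < n) (hzero : ∀ s < i, f s = 0) :
    cycleC n m r i ∣ f i := by
  have hpath : ∀ j, i ≤ j → j < n → gcd (m j) ((Finset.Ico i j).gcd r) ∣ f i := fun j hij hj =>
    (dvd_sub_right ((gcd_dvd_left _ _).trans (hf.1 j hj))).mp
      ((gcd_dvd_right _ _).trans (gcd_Ico_dvd_sub_of_mem_cycleSplines hf hij hj))
  unfold cycleC
  split_ifs with h
  · subst h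
    refine lcm_dvd (hf.1 0 hi) (lcm_dvd (Finset.lcm_dvd fun j hj => ?_)
      (Finset.lcm_dvd fun j hj => ?_))
    · exact hpath j j.zero_le (Finset.mem_Ico.mp hj).2
    · have hjn := (Finset.mem_Ico.mp hj).2
      exact (dvd_sub_left ((gcd_dvd_left _ _).trans (hf.1 j hjn))).mp
        ((gcd_dvd_right _ _).trans (gcd_Ico_dvd_zero_sub_of_mem_cycleSplines hf hjn))
  · refine lcm_dvd (lcm_dvd (hf.1 i hi) ?_) (lcm_dvd (Finset.lcm_dvd fun j hj => ?_) ?_)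
    · have hedge := hf.2.1 (i - 1) (by omega)
      rwa [Nat.sub_add_cancel (by omega), hzero (i - 1) (by omega), sub_zero] at hedge
    · have hj := Finset.mem_Ico.mp hj
      exact hpath j (by omega) hj.2
    · have hwrap := gcd_Ico_dvd_zero_sub_of_mem_cycleSplines hf hi
      rwa [hzero 0 (by omega), zero_sub, dvd_neg] at hwrap

theorem cycleC_ne_zero {n : ℕ} {m r : ℕ → ℤ} (hm : ∀ j < n, m j ≠ 0) (hr : ∀ j < n, r j ≠ 0)
    {i : ℕ} (hi : i < n) : cycleC n m r i ≠ 0 := by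
  have hlcm : ∀ (a : ℕ) (g : ℕ → ℤ), (Finset.Ico a n).lcm (fun j => gcd (m j) (g j)) ≠ 0 := by
    intro a g
    rw [Ne, Finset.lcm_eq_zero_iff]
    rintro ⟨j, hj, h⟩
    exact hm j (Finset.mem_Ico.mp hj).2 ((gcd_eq_zero_iff _ _).mp h).1
  unfold cycleC
  split_ifs with h
  · simp only [Ne, lcm_eq_zero_iff, not_or]
    exact ⟨hm 0 (by omega), hlcm _ _, hlcm _ _⟩
  · simp only [Ne, lcm_eq_zero_iff, not_or]
    refine ⟨⟨hm i hi, hr _ (by omega)⟩, hlcm _ _, fun h0 => ?_⟩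
    exact hr i hi (Finset.gcd_eq_zero_iff.mp h0 i (Finset.mem_Ico.mpr ⟨le_rfl, hi⟩))

/-- A triangular family with nonzero leading entries is linearly independent. -/
theorem eq_zero_of_sum_flowup_eq_zero {n : ℕ} {F : Fin n → ℕ → ℤ}
    (hflow : ∀ i : Fin n, ∀ s < (i : ℕ), F i s = 0) (hne : ∀ i : Fin n, F i i ≠ 0)
    {d : Fin n → ℤ} (hd : ∀ j < n, ∑ i, d i * F i j = 0) (i : Fin n) : d i = 0 := by
  induction i using WellFoundedLT.induction with
  | _ i ih =>
    have hi := hd i i.isLt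
    rw [Finset.sum_eq_single i (fun k _ hki => ?_) (by simp)] at hi
    · exact (mul_eq_zero.mp hi).resolve_right (hne i)
    · obtain hlt | hgt := lt_or_gt_of_ne hki
      · rw [ih k hlt, zero_mul]
      · rw [hflow k i hgt, mul_zero]

/-- A triangular family in a module `M` of sequences spans the first `n` entries of `M`, provided
its leading entries divide those of the elements of `M`. -/
theorem exists_eq_sum_flowup {n : ℕ} {M : Submodule ℤ (ℕ → ℤ)} {F : Fin n → ℕ → ℤ}
    (hF : ∀ i, F i ∈ M) (hflow : ∀ i : Fin n, ∀ s < (i : ℕ), F i s = 0)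
    (hdvd : ∀ i : Fin n, ∀ g ∈ M, (∀ s < (i : ℕ), g s = 0) → F i i ∣ g i)
    {f : ℕ → ℤ} (hf : f ∈ M) {k : ℕ} (hk : k ≤ n) :
    ∃ a : Fin n → ℤ, ∀ j < k, f j = ∑ i, a i * F i j := by
  induction k with
  | zero => exact ⟨0, by simp⟩
  | succ k ih =>
    obtain ⟨a, ha⟩ := ih (by omega)
    have hg : f - ∑ i, a i • F i ∈ M :=
      M.sub_mem hf (M.sum_mem fun i _ => M.smul_mem _ (hF i))
    obtain ⟨q, hq⟩ := hdvd ⟨k, hk⟩ _ hg fun s hs => by simp [ha s hs]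
    refine ⟨a + Pi.single ⟨k, hk⟩ q, fun j hj => ?_⟩
    have hsum : ∑ i, (a + Pi.single (⟨k, hk⟩ : Fin n) q : Fin n → ℤ) i * F i j
        = ∑ i, a i * F i j + q * F ⟨k, hk⟩ j := by
      simp [add_mul, Finset.sum_add_distrib, Pi.single_apply]
    rw [hsum]
    obtain hjk | rfl := Nat.lt_succ_iff_lt_or_eq.mp hj
    · rw [hflow ⟨k, hk⟩ j hjk, mul_zero, add_zero, ha j hjk]
    · simp only [Pi.sub_apply, Finset.sum_apply, Pi.smul_apply, smul_eq_mul] at hq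
      linarith

/-- any family of flow-up splines `F i` on the edge-labeled
cycle `Cₙ` with `F i s = 0` for `s < i` and `F i i = c i` is a ℤ-module basis
of the module of splines: every spline is a unique ℤ-linear combination of
the `F i`. -/
theorem cycle_minimal_flowups_form_basis (n : ℕ) (hn : 3 ≤ n) (m r : ℕ → ℤ)
    (hm : ∀ j < n, m j ≠ 0) (hrne : ∀ j < n, r j ≠ 0)
    (F : Fin n → ℕ → ℤ)
    (hFspline : ∀ i : Fin n,
      (∀ j < n, m j ∣ F i j) ∧
      (∀ j, j + 1 < n → r j ∣ F i (j + 1) - F i j) ∧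
      r (n - 1) ∣ F i 0 - F i (n - 1))
    (hFflow : ∀ i : Fin n, ∀ s < (i : ℕ), F i s = 0)
    (hFi : ∀ i : Fin n, F i i = cycleC n m r i) :
    ∀ f : ℕ → ℤ,
      ((∀ j < n, m j ∣ f j) ∧
        (∀ j, j + 1 < n → r j ∣ f (j + 1) - f j) ∧
        r (n - 1) ∣ f 0 - f (n - 1)) →
      ∃! a : Fin n → ℤ, ∀ j < n, f j = ∑ i, a i * F i j := by
  intro f hf
  have hne : ∀ i : Fin n, F i i ≠ 0 := fun i => by
    rw [hFi]
    exact cycleC_ne_zero hm hrne i.isLt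
  obtain ⟨a, ha⟩ := exists_eq_sum_flowup (M := cycleSplines n m r) hFspline hFflow
    (fun i g hg hzero => by
      rw [hFi]
      exact cycleC_dvd_of_mem_cycleSplines hg i.isLt hzero) hf le_rfl
  refine ⟨a, ha, fun b hb => funext fun i => sub_eq_zero.mp ?_⟩
  refine eq_zero_of_sum_flowup_eq_zero (d := fun i => b i - a i) hFflow hne (fun j hj => ?_) i
  simp only [sub_mul, Finset.sum_sub_distrib]
  rw [← hb j hj, ← ha j hj, sub_self]
end
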